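/- arXiv:1504.04930 — 9 statements merged into one kernel-verified Lean document; each statement's English description precedes it below -/
import Mathlib

section
/- Under the abstract model of the reduction network with single-edge robust decodability at the b-cut, the a-side structure with the vector map a injective on G, and the z'-factorization z'_i m = ζ_i (a m), suppose |A_err| ≤ E_a and |B_err| ≤ E_b. For each i ∈ Fin k let ψ_i : Fin N → Fin N be any plurality predictor of b_i from z'_i over G, and let π_i : Fin N → Fin N be any plurality predictor of a_i from b_i over G. Then the number of vectors w : Fin k → Fin N such that π_i (ψ_i (ζ_i w)) = w i for every i ∈ Fin k is at least N^k − k·(2·E_a + 4·E_b). (This is the engine of the paper's Theorem 1: with E_a = E_b = ε·2^{kn} it shows that a rate-k network error-correction code with error probability ε yields unit-rate multiple-unicast decoders with error probability at most 6kε.) -/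
/-- A plurality predictor makes at most as many mistakes as any other predictor. -/
theorem plurality_le {M : Type} {N : ℕ} (G : Finset M) (p q : M → Fin N) (h φ : Fin N → Fin N)
    (hp : ∀ c d, (G.filter (fun m => p m = c ∧ q m = d)).card ≤
      (G.filter (fun m => p m = c ∧ q m = h c)).card) :
    (G.filter (fun m => h (p m) ≠ q m)).card ≤ (G.filter (fun m => φ (p m) ≠ q m)).card := by
  classical
  have key : ∀ g : Fin N → Fin N, (G.filter (fun m => g (p m) = q m)).card =
      ∑ c, (G.filter (fun m => p m = c ∧ q m = g c)).card := by
    intro g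
    rw [Finset.card_eq_sum_card_fiberwise (f := p) (t := Finset.univ) (by intro x _; simp)]
    refine Finset.sum_congr rfl fun c _ => ?_
    congr 1
    ext m
    simp only [Finset.mem_filter]
    constructor
    · rintro ⟨⟨h1, h2⟩, h3⟩
      subst h3
      exact ⟨h1, rfl, h2.symm⟩
    · rintro ⟨h1, h2, h3⟩
      subst h2
      exact ⟨⟨h1, h3.symm⟩, rfl⟩
  have hle : (G.filter (fun m => φ (p m) = q m)).card ≤
      (G.filter (fun m => h (p m) = q m)).card := by
    rw [key φ, key h]
    exact Finset.sum_le_sum fun c _ => hp c _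
  have e1 := Finset.card_filter_add_card_filter_not (s := G) (fun m => φ (p m) = q m)
  have e2 := Finset.card_filter_add_card_filter_not (s := G) (fun m => h (p m) = q m)
  simp only [ne_eq]
  omega

/-- Coordinate slices of the cube have the same size. -/
theorem slice_le {k N : ℕ} (i : Fin k) (α β : Fin N) :
    (Finset.univ.filter (fun w : Fin k → Fin N => w i = β)).card ≤
    (Finset.univ.filter (fun w : Fin k → Fin N => w i = α)).card := by
  classical
  refine Finset.card_le_card_of_injOn (fun w => Function.update w i α) ?_ ?_
  · intro w _
    simp
  · intro w hw w' hw' h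
    simp only [Finset.coe_filter, Finset.mem_univ, true_and, Set.mem_setOf_eq] at hw hw'
    funext j
    by_cases hj : j = i
    · subst hj
      rw [hw, hw']
    · have := congrFun h j
      simpa [Function.update_of_ne hj] using this

/-- Engine of Theorem 1: under single-edge robust decodability at the
b-cut, the a-side structure with the vector map `a` injective on `G`, and the
z'-factorization `z'_i m = ζ_i (a m)`, if `|A_err| ≤ E_a` and `|B_err| ≤ E_b`, then
for any plurality predictors `ψ_i` (of `b_i` from `z'_i`) and `π_i` (of `a_i` from
`b_i`), the number of vectors `w` with `π_i (ψ_i (ζ_i w)) = w i` for every `i` is at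
least `N^k − k·(2·E_a + 4·E_b)`. -/
theorem reduction_engine
    (k N : ℕ) (hk : 1 ≤ k) (hN : 1 ≤ N)
    (M : Type) [Fintype M] [DecidableEq M]
    (G : Finset M)
    (x y z' b : Fin k → M → Fin N)
    (f : Fin k → Fin N → Fin N → Fin N → Fin N)
    (bv : M → Fin k → Fin N)
    (D : (Fin k → Fin N) → M)
    (hb : ∀ i m, b i m = f i (x i m) (y i m) (z' i m))
    (hbv : ∀ m i, bv m i = b i m)
    (hdec : ∀ m ∈ G, D (bv m) = m)
    (hdecx : ∀ m ∈ G, ∀ i v,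
      D (Function.update (bv m) i (f i v (y i m) (z' i m))) = m)
    (hdecy : ∀ m ∈ G, ∀ i v,
      D (Function.update (bv m) i (f i (x i m) v (z' i m))) = m)
    (hdecz : ∀ m ∈ G, ∀ i v,
      D (Function.update (bv m) i (f i (x i m) (y i m) v)) = m)
    (a : Fin k → M → Fin N) (ξ η : Fin k → Fin N → Fin N)
    (hx : ∀ i m, x i m = ξ i (a i m))
    (hy : ∀ i m, y i m = η i (a i m))
    (av : M → Fin k → Fin N)
    (hav : ∀ m i, av m i = a i m)
    (hainj : ∀ m₁ ∈ G, ∀ m₂ ∈ G, av m₁ = av m₂ → m₁ = m₂)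
    (ζ : Fin k → (Fin k → Fin N) → Fin N)
    (hz : ∀ i m, z' i m = ζ i (av m))
    (E_a E_b : ℕ)
    (hEa : (Finset.univ.filter (fun w : Fin k → Fin N => ∀ m ∈ G, w ≠ av m)).card ≤ E_a)
    (hEb : (Finset.univ.filter (fun w : Fin k → Fin N => ∀ m ∈ G, w ≠ bv m)).card ≤ E_b)
    (ψ : Fin k → Fin N → Fin N)
    (hψ : ∀ i ζ' β,
      (G.filter (fun m => z' i m = ζ' ∧ b i m = β)).card ≤
      (G.filter (fun m => z' i m = ζ' ∧ b i m = ψ i ζ')).card)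
    (π : Fin k → Fin N → Fin N)
    (hπ : ∀ i β α,
      (G.filter (fun m => b i m = β ∧ a i m = α)).card ≤
      (G.filter (fun m => b i m = β ∧ a i m = π i β)).card) :
    ((N : ℤ) ^ k - k * (2 * E_a + 4 * E_b)) ≤
      ((Finset.univ.filter
        (fun w : Fin k → Fin N => ∀ i, π i (ψ i (ζ i w)) = w i)).card : ℤ) := by
  classical
  set A := Finset.univ.filter (fun w : Fin k → Fin N => ∀ m ∈ G, w ≠ av m) with hA
  set B := Finset.univ.filter (fun w : Fin k → Fin N => ∀ m ∈ G, w ≠ bv m) with hB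
  set T := B.image D with hTdef
  have hTc : T.card ≤ E_b := Finset.card_image_le.trans hEb
  have hT : ∀ m ∈ G, ∀ i γ, γ ≠ b i m → D (Function.update (bv m) i γ) = m → m ∈ T := by
    intro m hm i γ hγ hD
    refine Finset.mem_image.2 ⟨_, ?_, hD⟩
    simp only [hB, Finset.mem_filter, Finset.mem_univ, true_and]
    intro m' hm' heq
    have h1 : m' = m := by
      rw [← hdec m' hm', ← heq, hD]
    subst h1
    apply hγ
    have := congrFun heq i
    rw [Function.update_self, hbv] at this
    exact this
  have hZ : ∀ i, ∀ m₁ ∈ G, ∀ m₂ ∈ G, z' i m₁ = z' i m₂ → m₁ ∉ T → m₂ ∉ T → b i m₁ = b i m₂ := by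
    intro i m₁ h₁ m₂ h₂ hzz t₁ t₂
    have e1 : f i (x i m₁) (y i m₂) (z' i m₁) = b i m₁ := by
      by_contra hne
      exact t₁ (hT m₁ h₁ i _ hne (hdecy m₁ h₁ i _))
    have e2 : f i (x i m₁) (y i m₂) (z' i m₂) = b i m₂ := by
      by_contra hne
      exact t₂ (hT m₂ h₂ i _ hne (hdecx m₂ h₂ i _))
    rw [← e1, ← e2, hzz]
  have hAB : ∀ i, ∀ m₁ ∈ G, ∀ m₂, a i m₁ = a i m₂ → m₁ ∉ T → b i m₂ = b i m₁ := by
    intro i m₁ h₁ m₂ haa t₁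
    by_contra hne
    refine t₁ (hT m₁ h₁ i _ hne ?_)
    have : b i m₂ = f i (x i m₁) (y i m₁) (z' i m₂) := by
      rw [hb, hx, hy, hx i m₁, hy i m₁, haa]
    rw [this]
    exact hdecz m₁ h₁ i _
  have hP : ∀ i, (G.filter (fun m => ψ i (z' i m) ≠ b i m)).card ≤ E_b := by
    intro i
    let φ : Fin N → Fin N := fun c =>
      if h : ∃ m ∈ G, m ∉ T ∧ z' i m = c then b i h.choose else c
    refine (plurality_le G (z' i) (b i) (ψ i) φ (hψ i)).trans
      ((Finset.card_le_card ?_).trans hTc)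
    intro m hm
    rw [Finset.mem_filter] at hm
    by_contra hmT
    apply hm.2
    have h : ∃ m' ∈ G, m' ∉ T ∧ z' i m' = z' i m := ⟨m, hm.1, hmT, rfl⟩
    simp only [φ, dif_pos h]
    exact hZ i _ h.choose_spec.1 m hm.1 h.choose_spec.2.2 h.choose_spec.2.1 hmT
  have hQ : ∀ i, (G.filter (fun m => π i (b i m) ≠ a i m)).card ≤ E_b + E_a := by
    intro i
    let good : Fin N → Prop := fun c => ∃ m ∈ G, m ∉ T ∧ b i m = c
    let φ : Fin N → Fin N := fun c => if h : good c then a i h.choose else c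
    have hφ : ∀ c, good c → ∃ m ∈ G, m ∉ T ∧ b i m = c ∧ a i m = φ c := by
      intro c h
      refine ⟨h.choose, h.choose_spec.1, h.choose_spec.2.1, h.choose_spec.2.2, ?_⟩
      simp only [φ, dif_pos h]
    refine (plurality_le G (b i) (a i) (π i) φ (hπ i)).trans ?_
    let R := G.filter (fun m => φ (b i m) ≠ a i m ∧ good (b i m))
    have hsub : G.filter (fun m => φ (b i m) ≠ a i m) ⊆ T ∪ R := by
      intro m hm
      rw [Finset.mem_filter] at hm
      rw [Finset.mem_union]
      by_cases hmT : m ∈ T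
      · exact Or.inl hmT
      · exact Or.inr (Finset.mem_filter.2 ⟨hm.1, hm.2, m, hm.1, hmT, rfl⟩)
    have hR : R.card ≤ A.card := by
      let S := Finset.univ.filter good
      have hfib : ∀ c ∈ S, (R.filter (fun m => b i m = c)).card ≤
          (A.filter (fun w => w i = φ c)).card := by
        intro c hc
        have hg : good c := (Finset.mem_filter.1 hc).2
        obtain ⟨m₀, h₀, t₀, hb₀, ha₀⟩ := hφ c hg
        have c1 : (R.filter (fun m => b i m = c)).card +
            (G.filter (fun m => a i m = φ c)).card ≤ (G.filter (fun m => b i m = c)).card := by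
          rw [← Finset.card_union_of_disjoint]
          · apply Finset.card_le_card
            intro m hm
            simp only [Finset.mem_union, Finset.mem_filter, R] at hm ⊢
            rcases hm with hm | hm
            · exact ⟨hm.1.1, hm.2⟩
            · refine ⟨hm.1, ?_⟩
              rw [hAB i m₀ h₀ m (ha₀.trans hm.2.symm) t₀, hb₀]
          · rw [Finset.disjoint_left]
            intro m hm hm'
            simp only [Finset.mem_filter, R] at hm hm'
            apply hm.1.2.1
            rw [hm.2, hm'.2]
        have c2 : (G.filter (fun m => b i m = c)).card ≤
            (Finset.univ.filter (fun w : Fin k → Fin N => w i = c)).card := by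
          refine Finset.card_le_card_of_injOn bv ?_ ?_
          · intro m hm
            simp only [Finset.coe_filter, Set.mem_setOf_eq] at hm
            simp [hbv, hm.2]
          · intro m hm m' hm' h
            simp only [Finset.coe_filter, Set.mem_setOf_eq] at hm hm'
            rw [← hdec m hm.1, ← hdec m' hm'.1, h]
        have c3 := slice_le (k := k) i (φ c) c
        have c4 : (Finset.univ.filter (fun w : Fin k → Fin N => w i = φ c)).card ≤
            (A.filter (fun w => w i = φ c)).card +
            (G.filter (fun m => a i m = φ c)).card := by
          refine le_trans (Finset.card_le_card (t := A.filter (fun w => w i = φ c) ∪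
            (G.filter (fun m => a i m = φ c)).image av) ?_)
            ((Finset.card_union_le _ _).trans
              (Nat.add_le_add_left Finset.card_image_le _))
          intro w hw
          simp only [Finset.mem_filter, Finset.mem_univ, true_and] at hw
          rw [Finset.mem_union]
          by_cases hwA : w ∈ A
          · exact Or.inl (Finset.mem_filter.2 ⟨hwA, hw⟩)
          · right
            simp only [hA, Finset.mem_filter, Finset.mem_univ, true_and] at hwA
            push Not at hwA
            obtain ⟨m, hm, rfl⟩ := hwA
            exact Finset.mem_image.2 ⟨m, Finset.mem_filter.2 ⟨hm, by rw [← hav]; exact hw⟩, rfl⟩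
        omega
      have hinj : Set.InjOn φ (S : Set (Fin N)) := by
        intro c hc d hd hcd
        have hc' : good c := (Finset.mem_filter.1 hc).2
        have hd' : good d := (Finset.mem_filter.1 hd).2
        obtain ⟨m₁, h₁, t₁, hb₁, ha₁⟩ := hφ c hc'
        obtain ⟨m₂, h₂, t₂, hb₂, ha₂⟩ := hφ d hd'
        rw [← hb₁, ← hb₂]
        exact (hAB i m₁ h₁ m₂ (by rw [ha₁, ha₂, hcd]) t₁).symm
      calc R.card = ∑ c ∈ S, (R.filter (fun m => b i m = c)).card := by
            apply Finset.card_eq_sum_card_fiberwise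
            intro m hm
            have hm' : m ∈ R := hm
            have := (Finset.mem_filter.1 hm').2.2
            exact Finset.mem_coe.2 (Finset.mem_filter.2 ⟨Finset.mem_univ _, this⟩)
        _ ≤ ∑ c ∈ S, (A.filter (fun w => w i = φ c)).card := Finset.sum_le_sum hfib
        _ = ∑ d ∈ S.image φ, (A.filter (fun w => w i = d)).card := by
            rw [Finset.sum_image hinj]
        _ ≤ ∑ d, (A.filter (fun w => w i = d)).card :=
            Finset.sum_le_sum_of_subset (Finset.subset_univ _)
        _ = A.card := by
            symm
            apply Finset.card_eq_sum_card_fiberwise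
            intro w _
            simp
    calc _ ≤ (T ∪ R).card := Finset.card_le_card hsub
      _ ≤ T.card + R.card := Finset.card_union_le _ _
      _ ≤ E_b + E_a := Nat.add_le_add hTc (hR.trans hEa)
  set W := Finset.univ.filter (fun w : Fin k → Fin N => ∀ i, π i (ψ i (ζ i w)) = w i) with hW
  let C : Fin k → Finset (Fin k → Fin N) := fun i =>
    A ∪ ((G.filter (fun m => ψ i (z' i m) ≠ b i m)).image av ∪
      (G.filter (fun m => π i (b i m) ≠ a i m)).image av)
  have hC : ∀ i, (C i).card ≤ 2 * E_a + 4 * E_b := by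
    intro i
    have h1 := Finset.card_union_le A ((G.filter (fun m => ψ i (z' i m) ≠ b i m)).image av ∪
      (G.filter (fun m => π i (b i m) ≠ a i m)).image av)
    have h2 := Finset.card_union_le ((G.filter (fun m => ψ i (z' i m) ≠ b i m)).image av)
      ((G.filter (fun m => π i (b i m) ≠ a i m)).image av)
    have h3 := (Finset.card_image_le (s := G.filter (fun m => ψ i (z' i m) ≠ b i m))
      (f := av)).trans (hP i)
    have h4 := (Finset.card_image_le (s := G.filter (fun m => π i (b i m) ≠ a i m))
      (f := av)).trans (hQ i)
    change (A ∪ _).card ≤ _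
    omega
  have hcov : (Finset.univ : Finset (Fin k → Fin N)) ⊆ W ∪ Finset.univ.biUnion C := by
    intro w _
    rw [Finset.mem_union]
    by_cases hw : w ∈ W
    · exact Or.inl hw
    right
    simp only [hW, Finset.mem_filter, Finset.mem_univ, true_and] at hw
    push Not at hw
    obtain ⟨i, hi⟩ := hw
    refine Finset.mem_biUnion.2 ⟨i, Finset.mem_univ _, ?_⟩
    by_cases hwA : w ∈ A
    · exact Finset.mem_union_left _ hwA
    simp only [hA, Finset.mem_filter, Finset.mem_univ, true_and] at hwA
    push Not at hwA
    obtain ⟨m, hm, rfl⟩ := hwA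
    rw [← hz, hav] at hi
    apply Finset.mem_union_right
    by_cases hbm : ψ i (z' i m) = b i m
    · apply Finset.mem_union_right
      rw [hbm] at hi
      exact Finset.mem_image_of_mem _ (Finset.mem_filter.2 ⟨hm, hi⟩)
    · apply Finset.mem_union_left
      exact Finset.mem_image_of_mem _ (Finset.mem_filter.2 ⟨hm, hbm⟩)
  have hfin : N ^ k ≤ W.card + k * (2 * E_a + 4 * E_b) := by
    have h1 := Finset.card_le_card hcov
    have h2 := Finset.card_union_le W (Finset.univ.biUnion C)
    have h3 := Finset.card_biUnion_le_card_mul Finset.univ C _ (fun i _ => hC i)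
    simp only [Finset.card_univ, Fintype.card_pi, Fintype.card_fin, Finset.prod_const] at h1 h3
    omega
  have : ((N ^ k : ℕ) : ℤ) ≤ ((W.card + k * (2 * E_a + 4 * E_b) : ℕ) : ℤ) := by
    exact_mod_cast hfin
  push_cast at this
  linarith
end

section
/- For all integers k ≥ 1 and r ≥ 0, with V = Fin r → ZMod 2, there exist a node function β : V → V → V → V × Bool and a decoder δ : (Fin k → V × Bool) → (Fin k → V) such that for every message m : Fin k → V, writing s = ∑ j, m j, and for every received family of signals X, Y, Z : Fin k → V arising from at most one edge error — i.e., satisfying one of: (i) X = m, Y = m, and Z i = s for all i (no error); (ii) there is i₀ such that Y = m, Z i = s for all i, and X i = m i for all i ≠ i₀ (X i₀ arbitrary); (iii) there is i₀ such that X = m, Z i = s for all i, and Y i = m i for all i ≠ i₀ (Y i₀ arbitrary); (iv) there is i₀ such that X = m, Y = m, and Z i = s for all i ≠ i₀ (Z i₀ arbitrary); (v) X = m, Y = m, and Z is a constant function (all Z i equal to one common arbitrary value) — one has δ (fun i => β (X i) (Y i) (Z i)) = m. (This is the coding scheme proving the first statement of Theorem 2: in the network of Figure 2, rate k(n−1)/n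 is feasible with zero error against any single-edge error, so rate k is asymptotically feasible.) -/
/-- The zero-error single-edge-error-correcting coding scheme of Theorem 2
(Figure 2): messages are `(n-1)`-bit vectors `V = Fin r → ZMod 2`; each node `B_i`
applies the same function `β` to its inputs `(X i, Y i, Z i)`, and the terminal applies
decoder `δ`; decoding is correct under any single-edge error. -/
theorem single_edge_error_correction_code_exists (k r : ℕ) (hk : 1 ≤ k) :
    ∃ β : (Fin r → ZMod 2) → (Fin r → ZMod 2) → (Fin r → ZMod 2) →
          (Fin r → ZMod 2) × Bool,
    ∃ δ : (Fin k → (Fin r → ZMod 2) × Bool) → (Fin k → (Fin r → ZMod 2)),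
      ∀ m X Y Z : Fin k → (Fin r → ZMod 2),
        ((X = m ∧ Y = m ∧ (∀ i, Z i = ∑ j, m j)) ∨
         (∃ i₀, Y = m ∧ (∀ i, Z i = ∑ j, m j) ∧ (∀ i, i ≠ i₀ → X i = m i)) ∨
         (∃ i₀, X = m ∧ (∀ i, Z i = ∑ j, m j) ∧ (∀ i, i ≠ i₀ → Y i = m i)) ∨
         (∃ i₀, X = m ∧ Y = m ∧ (∀ i, i ≠ i₀ → Z i = ∑ j, m j)) ∨
         (X = m ∧ Y = m ∧ (∃ c, ∀ i, Z i = c))) →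
        δ (fun i => β (X i) (Y i) (Z i)) = m := by
  classical
  refine ⟨fun x y z => if x = y then (x, false) else (z, true),
    fun f i => if (f i).2 then (f i).1 - ∑ j ∈ Finset.univ.erase i, (f j).1 else (f i).1, ?_⟩
  intro m X Y Z h
  have key : ∀ i, (X i = m i ∧ Y i = m i) ∨
      (X i ≠ Y i ∧ Z i = ∑ j, m j ∧ ∀ j, j ≠ i → X j = m j ∧ Y j = m j) := by
    intro i
    rcases h with ⟨rfl, rfl, -⟩ | ⟨i₀, rfl, hZ, hX⟩ | ⟨i₀, rfl, hZ, hY⟩ | ⟨i₀, rfl, rfl, -⟩ |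
      ⟨rfl, rfl, -⟩
    · exact Or.inl ⟨rfl, rfl⟩
    · by_cases hi : X i = Y i
      · exact Or.inl ⟨hi, rfl⟩
      · have hii : i = i₀ := by
          by_contra hne
          exact hi (hX i hne)
        subst hii
        exact Or.inr ⟨hi, hZ i, fun j hj => ⟨hX j hj, rfl⟩⟩
    · by_cases hi : Y i = X i
      · exact Or.inl ⟨rfl, hi⟩
      · have hii : i = i₀ := by
          by_contra hne
          exact hi (hY i hne)
        subst hii
        exact Or.inr ⟨fun e => hi e.symm, hZ i, fun j hj => ⟨rfl, hY j hj⟩⟩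
    · exact Or.inl ⟨rfl, rfl⟩
    · exact Or.inl ⟨rfl, rfl⟩
  funext i
  rcases key i with ⟨h1, h2⟩ | ⟨h1, h2, h3⟩
  · simp [h1, h2]
  · have hs : ∑ j ∈ Finset.univ.erase i, (if X j = Y j then (X j, false) else (Z j, true)).1
        = ∑ j ∈ Finset.univ.erase i, m j := by
      refine Finset.sum_congr rfl fun j hj => ?_
      obtain ⟨a, b⟩ := h3 j (Finset.ne_of_mem_erase hj)
      simp [a, b]
    simp only [hs, if_neg h1, if_true]
    rw [h2, ← Finset.add_sum_erase _ _ (Finset.mem_univ i), add_sub_cancel_right]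
end

section
/- Under the abstract model of the reduction network with single-edge robust decodability at the b-cut, the a-side structure with the vector map a injective on G, the z'-factorization z'_i m = ζ_i (a m), and additionally a single-edge bottleneck — there exist h : (Fin k → Fin N) → Fin N and g_i : Fin N → Fin N with ζ_i = g_i ∘ h for all i ∈ Fin k — if |A_err| ≤ E_a and |B_err| ≤ E_b, then N^k ≤ N + k·(2·E_a + 4·E_b). (This is the engine of Corollary 2: in the network of Figure 2 every z'_i is a function of the single signal on edge (C,D); with E_a = E_b = ε·2^{kn} the inequality fails for k ≥ 2, N ≥ 2 and small ε, so rate k is not feasible in that instance even though its capacity equals k — the single-unicast network error-correction capacity is not achievable in general.) -/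
theorem cyl_card (k N : ℕ) (i : Fin k) (S : Finset (Fin N)) :
    (Finset.univ.filter (fun w : Fin k → Fin N => w i ∈ S)).card = S.card * N ^ (k - 1) := by
  have h1 : (Finset.univ.filter (fun w : Fin k → Fin N => w i ∈ S))
      = Fintype.piFinset (Function.update (fun _ => Finset.univ) i S) := by
    ext w
    simp only [Finset.mem_filter, Finset.mem_univ, true_and, Fintype.mem_piFinset]
    constructor
    · intro hw j
      by_cases hj : j = i
      · subst hj; simpa using hw
      · simp [hj]
    · intro hw
      simpa using hw i
  rw [h1, Fintype.card_piFinset]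
  rw [← Finset.mul_prod_erase Finset.univ _ (Finset.mem_univ i)]
  rw [Finset.prod_congr rfl (g := fun _ => N)]
  · simp
  · intro j hj
    have : j ≠ i := Finset.ne_of_mem_erase hj
    simp [this]

/-- Engine of Corollary 2: under single-edge robust decodability at the
b-cut, the a-side structure with the vector map `a` injective on `G`, the
z'-factorization `z'_i m = ζ_i (a m)`, and a single-edge bottleneck `ζ_i = g_i ∘ h`,
if `|A_err| ≤ E_a` and `|B_err| ≤ E_b`, then `N^k ≤ N + k·(2·E_a + 4·E_b)`. -/
theorem capacity_unachievability_engine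
    (k N : ℕ) (hk : 1 ≤ k) (hN : 1 ≤ N)
    (M : Type) [Fintype M] [DecidableEq M]
    (G : Finset M)
    (x y z' b : Fin k → M → Fin N)
    (f : Fin k → Fin N → Fin N → Fin N → Fin N)
    (bv : M → Fin k → Fin N)
    (D : (Fin k → Fin N) → M)
    (hb : ∀ i m, b i m = f i (x i m) (y i m) (z' i m))
    (hbv : ∀ m i, bv m i = b i m)
    (hdec : ∀ m ∈ G, D (bv m) = m)
    (hdecx : ∀ m ∈ G, ∀ i v,
      D (Function.update (bv m) i (f i v (y i m) (z' i m))) = m)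
    (hdecy : ∀ m ∈ G, ∀ i v,
      D (Function.update (bv m) i (f i (x i m) v (z' i m))) = m)
    (hdecz : ∀ m ∈ G, ∀ i v,
      D (Function.update (bv m) i (f i (x i m) (y i m) v)) = m)
    (a : Fin k → M → Fin N) (ξ η : Fin k → Fin N → Fin N)
    (hx : ∀ i m, x i m = ξ i (a i m))
    (hy : ∀ i m, y i m = η i (a i m))
    (av : M → Fin k → Fin N)
    (hav : ∀ m i, av m i = a i m)
    (hainj : ∀ m₁ ∈ G, ∀ m₂ ∈ G, av m₁ = av m₂ → m₁ = m₂)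
    (ζ : Fin k → (Fin k → Fin N) → Fin N)
    (hz : ∀ i m, z' i m = ζ i (av m))
    (h : (Fin k → Fin N) → Fin N) (g : Fin k → Fin N → Fin N)
    (hbottleneck : ∀ i, ζ i = g i ∘ h)
    (E_a E_b : ℕ)
    (hEa : (Finset.univ.filter (fun w : Fin k → Fin N => ∀ m ∈ G, w ≠ av m)).card ≤ E_a)
    (hEb : (Finset.univ.filter (fun w : Fin k → Fin N => ∀ m ∈ G, w ≠ bv m)).card ≤ E_b) :
    N ^ k ≤ N + k * (2 * E_a + 4 * E_b) := by
  classical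
  set Berr := Finset.univ.filter (fun w : Fin k → Fin N => ∀ m ∈ G, w ≠ bv m) with hBerr
  have key : ∀ i : Fin k, ∃ Bad : Finset M, Bad.card ≤ 3 * E_b ∧
      ∀ m₁ ∈ G, m₁ ∉ Bad → ∀ m₂ ∈ G, m₂ ∉ Bad → z' i m₁ = z' i m₂ → a i m₁ = a i m₂ := by
    intro i
    set Gi := G.filter (fun m =>
      (∀ v, f i v (y i m) (z' i m) = b i m) ∧ (∀ v, f i (x i m) v (z' i m) = b i m) ∧
      (∀ v, f i (x i m) (y i m) v = b i m)) with hGi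
    have hmem : ∀ m, m ∈ Gi ↔ m ∈ G ∧ (∀ v, f i v (y i m) (z' i m) = b i m) ∧
        (∀ v, f i (x i m) v (z' i m) = b i m) ∧ (∀ v, f i (x i m) (y i m) v = b i m) := by
      intro m
      simp [hGi]
    have herr : ∀ m ∈ G, ∀ c, D (Function.update (bv m) i c) = m → c ≠ b i m →
        m ∈ Berr.image D := by
      intro m hm c hD hc
      refine Finset.mem_image.2 ⟨_, ?_, hD⟩
      refine Finset.mem_filter.2 ⟨Finset.mem_univ _, ?_⟩
      intro m' hm' he
      rw [he, hdec m' hm'] at hD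
      subst hD
      have := congrFun he i
      rw [Function.update_self, hbv] at this
      exact hc this
    have hsub : G \ Gi ⊆ Berr.image D := by
      intro m hm
      obtain ⟨hm, hn⟩ := Finset.mem_sdiff.1 hm
      by_contra hc
      apply hn
      rw [hmem]
      refine ⟨hm, fun v => ?_, fun v => ?_, fun v => ?_⟩
      · by_contra h'
        exact hc (herr m hm _ (hdecx m hm i v) h')
      · by_contra h'
        exact hc (herr m hm _ (hdecy m hm i v) h')
      · by_contra h'
        exact hc (herr m hm _ (hdecz m hm i v) h')
    have hcard1 : (G \ Gi).card ≤ E_b :=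
      (Finset.card_le_card hsub).trans (Finset.card_image_le.trans hEb)
    have hzb : ∀ m₁ ∈ Gi, ∀ m₂ ∈ Gi, z' i m₁ = z' i m₂ → b i m₁ = b i m₂ := by
      intro m₁ h₁ m₂ h₂ e
      obtain ⟨_, p1, p2, p3⟩ := (hmem _).1 h₁
      obtain ⟨_, q1, q2, q3⟩ := (hmem _).1 h₂
      rw [← p1 (x i m₂), ← q2 (y i m₁), e]
    have hab : ∀ m₁ ∈ Gi, ∀ m₂ ∈ Gi, a i m₁ = a i m₂ → b i m₁ = b i m₂ := by
      intro m₁ h₁ m₂ h₂ e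
      obtain ⟨_, p1, p2, p3⟩ := (hmem _).1 h₁
      have e1 : x i m₁ = x i m₂ := by rw [hx, hx, e]
      have e2 : y i m₁ = y i m₂ := by rw [hy, hy, e]
      rw [← p3 (z' i m₂), hb i m₂, e1, e2]
    set T := Gi.image (b i) with hT
    have hch : ∀ β : Fin N, ∃ c : Fin N, β ∈ T → ∃ m ∈ Gi, b i m = β ∧ a i m = c := by
      intro β
      by_cases hβ : β ∈ T
      · obtain ⟨m, hm, e⟩ := Finset.mem_image.1 hβ
        exact ⟨a i m, fun _ => ⟨m, hm, e, rfl⟩⟩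
      · exact ⟨β, fun h' => absurd h' hβ⟩
    choose s hs using hch
    have hsinj : Set.InjOn s (T : Set (Fin N)) := by
      intro β₁ h₁ β₂ h₂ e
      obtain ⟨m₁, g₁, r₁, t₁⟩ := hs β₁ h₁
      obtain ⟨m₂, g₂, r₂, t₂⟩ := hs β₂ h₂
      rw [← r₁, ← r₂]
      exact hab _ g₁ _ g₂ (by rw [t₁, t₂, e])
    have hcardR : ((T.image s)ᶜ).card = (Tᶜ).card := by
      rw [Finset.card_compl, Finset.card_compl, Finset.card_image_of_injOn hsinj]
    have hTc : (Finset.univ.filter (fun w : Fin k → Fin N => w i ∈ Tᶜ)).card ≤ E_b + E_b := by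
      have hsub2 : (Finset.univ.filter (fun w : Fin k → Fin N => w i ∈ Tᶜ))
          ⊆ Berr ∪ (G \ Gi).image bv := by
        intro w hw
        have hw' : w i ∉ T := by simpa using hw
        by_cases hB : w ∈ Berr
        · exact Finset.mem_union_left _ hB
        · apply Finset.mem_union_right
          have : ∃ m ∈ G, w = bv m := by
            by_contra hc
            push Not at hc
            exact hB (Finset.mem_filter.2 ⟨Finset.mem_univ _, hc⟩)
          obtain ⟨m, hm, rfl⟩ := this
          refine Finset.mem_image_of_mem _ (Finset.mem_sdiff.2 ⟨hm, fun hg => hw' ?_⟩)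
          rw [hbv]
          exact Finset.mem_image_of_mem _ hg
      exact (Finset.card_le_card hsub2).trans ((Finset.card_union_le _ _).trans
        (Nat.add_le_add hEb (Finset.card_image_le.trans hcard1)))
    have hcard2 : (G.filter (fun m => a i m ∉ T.image s)).card ≤ E_b + E_b := by
      refine le_trans ?_ hTc
      rw [cyl_card, ← hcardR, ← cyl_card]
      refine Finset.card_le_card_of_injOn av ?_ ?_
      · intro m hm
        have hm' := (Finset.mem_filter.1 hm).2
        refine Finset.mem_coe.2 (Finset.mem_filter.2 ⟨Finset.mem_univ _, ?_⟩)
        rw [hav, Finset.mem_compl]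
        exact hm'
      · intro m₁ h₁ m₂ h₂ e
        exact hainj _ (Finset.mem_filter.1 h₁).1 _ (Finset.mem_filter.1 h₂).1 e
    refine ⟨(G \ Gi) ∪ G.filter (fun m => a i m ∉ T.image s), ?_, ?_⟩
    · have := Finset.card_union_le (G \ Gi) (G.filter (fun m => a i m ∉ T.image s))
      omega
    · have hgood : ∀ m ∈ G, m ∉ (G \ Gi) ∪ G.filter (fun m => a i m ∉ T.image s) →
          m ∈ Gi ∧ a i m = s (b i m) := by
        intro m hm hn
        rw [Finset.mem_union, not_or] at hn
        obtain ⟨n1, n2⟩ := hn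
        have g1 : m ∈ Gi := by
          by_contra hc
          exact n1 (Finset.mem_sdiff.2 ⟨hm, hc⟩)
        have g2 : a i m ∈ T.image s := by
          by_contra hc
          exact n2 (Finset.mem_filter.2 ⟨hm, hc⟩)
        refine ⟨g1, ?_⟩
        obtain ⟨β, hβ, e⟩ := Finset.mem_image.1 g2
        obtain ⟨m', g', r', t'⟩ := hs β hβ
        have : b i m = b i m' := hab _ g1 _ g' (by rw [t', e])
        rw [this, r', e]
      intro m₁ h₁ n₁ m₂ h₂ n₂ e
      obtain ⟨g₁, e₁⟩ := hgood _ h₁ n₁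
      obtain ⟨g₂, e₂⟩ := hgood _ h₂ n₂
      rw [e₁, e₂, hzb _ g₁ _ g₂ e]
  choose Bad hBad hdet using key
  set U := Finset.univ.biUnion Bad with hU
  have hUcard : U.card ≤ k * (3 * E_b) := by
    have := Finset.card_biUnion_le_card_mul (Finset.univ : Finset (Fin k)) Bad (3 * E_b)
      (fun i _ => hBad i)
    simpa using this
  have hGU : (G \ U).card ≤ N := by
    have : (G \ U).card ≤ (Finset.univ : Finset (Fin N)).card := by
      refine Finset.card_le_card_of_injOn (fun m => h (av m)) (fun _ _ => by simp) ?_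
      intro m₁ h₁ m₂ h₂ e
      obtain ⟨g₁, n₁⟩ := Finset.mem_sdiff.1 h₁
      obtain ⟨g₂, n₂⟩ := Finset.mem_sdiff.1 h₂
      refine hainj _ g₁ _ g₂ (funext fun i => ?_)
      rw [hav, hav]
      have hn : ∀ m, m ∉ U → m ∉ Bad i := fun m hm hc =>
        hm (Finset.mem_biUnion.2 ⟨i, Finset.mem_univ _, hc⟩)
      refine hdet i _ g₁ (hn _ n₁) _ g₂ (hn _ n₂) ?_
      rw [hz, hz, hbottleneck]
      exact congrArg (g i) e
    simpa using this
  have hGcard : G.card ≤ N + k * (3 * E_b) := by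
    have h1 : G ⊆ (G \ U) ∪ U := by
      intro m hm
      by_cases hu : m ∈ U <;> simp [hm, hu]
    have h2 := (Finset.card_le_card h1).trans (Finset.card_union_le _ _)
    omega
  have htot : N ^ k ≤ E_b + G.card := by
    have h1 : (Finset.univ : Finset (Fin k → Fin N)) ⊆ Berr ∪ G.image bv := by
      intro w _
      by_cases hB : w ∈ Berr
      · exact Finset.mem_union_left _ hB
      · apply Finset.mem_union_right
        by_contra hc
        apply hB
        refine Finset.mem_filter.2 ⟨Finset.mem_univ _, fun m hm e => hc ?_⟩
        rw [e]
        exact Finset.mem_image_of_mem _ hm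
    have h2 := (Finset.card_le_card h1).trans (Finset.card_union_le _ _)
    have h3 : (G.image bv).card ≤ G.card := Finset.card_image_le
    have h4 : (Finset.univ : Finset (Fin k → Fin N)).card = N ^ k := by simp
    omega
  have hkE : E_b ≤ k * E_b := Nat.le_mul_of_pos_left _ hk
  nlinarith [Nat.zero_le (k * E_a)]
end

section
/- Under the abstract model of the reduction network with single-edge robust decodability at the b-cut: for every i ∈ Fin k, if m₁, m₂ ∈ G satisfy z'_i m₁ = z'_i m₂ and b_i m₁ ≠ b_i m₂, then there exists a vector w ∈ B_err such that D w = m₁ or D w = m₂. (Paper's Lemma 4.) -/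
/-- Paper's Lemma 4: under single-edge robust decodability at the b-cut,
if two correctly decodable messages agree on `z'_i` but disagree on `b_i`, then some
element of `B_err` is decoded by the terminal to one of the two messages. -/
theorem lemma_four
    (k N : ℕ) (hk : 1 ≤ k) (hN : 1 ≤ N)
    (M : Type) [Fintype M] [DecidableEq M]
    (G : Finset M)
    (x y z' b : Fin k → M → Fin N)
    (f : Fin k → Fin N → Fin N → Fin N → Fin N)
    (bv : M → Fin k → Fin N)
    (D : (Fin k → Fin N) → M)
    (hb : ∀ i m, b i m = f i (x i m) (y i m) (z' i m))
    (hbv : ∀ m i, bv m i = b i m)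
    (hdec : ∀ m ∈ G, D (bv m) = m)
    (hdecx : ∀ m ∈ G, ∀ i v,
      D (Function.update (bv m) i (f i v (y i m) (z' i m))) = m)
    (hdecy : ∀ m ∈ G, ∀ i v,
      D (Function.update (bv m) i (f i (x i m) v (z' i m))) = m)
    (hdecz : ∀ m ∈ G, ∀ i v,
      D (Function.update (bv m) i (f i (x i m) (y i m) v)) = m)
    (i : Fin k) (m₁ m₂ : M) (hm₁ : m₁ ∈ G) (hm₂ : m₂ ∈ G)
    (hz : z' i m₁ = z' i m₂) (hbne : b i m₁ ≠ b i m₂) :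
    ∃ w ∈ Finset.univ.filter (fun w : Fin k → Fin N => ∀ m ∈ G, w ≠ bv m),
      D w = m₁ ∨ D w = m₂ := by
  have key : ∀ m₀ ∈ G, ∀ c, D (Function.update (bv m₀) i c) = m₀ → c ≠ b i m₀ →
      Function.update (bv m₀) i c ∈
        Finset.univ.filter (fun w : Fin k → Fin N => ∀ m ∈ G, w ≠ bv m) := by
    intro m₀ _ c hD hc
    refine Finset.mem_filter.mpr ⟨Finset.mem_univ _, fun m hm h => hc ?_⟩
    have hmm : m = m₀ := by rw [← hdec m hm, ← h, hD]
    subst hmm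
    have h2 := congrFun h i
    rw [Function.update_self, hbv] at h2
    exact h2
  have h1 := hdecy m₁ hm₁ i (y i m₂)
  have h2 := hdecx m₂ hm₂ i (x i m₁)
  rw [← hz] at h2
  by_cases hc : f i (x i m₁) (y i m₂) (z' i m₁) = b i m₁
  · exact ⟨_, key m₂ hm₂ _ h2 (fun h => hbne (hc.symm.trans h)), Or.inr h2⟩
  · exact ⟨_, key m₁ hm₁ _ h1 hc, Or.inl h1⟩
end

section
/- Under the abstract model of the reduction network with single-edge robust decodability at the b-cut: for every i ∈ Fin k and every plurality predictor ψ_i of b_i from z'_i over G, the number of good messages on which ψ_i errs satisfies |{m ∈ G : ψ_i (z'_i m) ≠ b_i m}| ≤ 2·|B_err|. (Paper's Lemma 1: with |B_err| ≤ ε·2^{kn} this gives |M^ψ_i| ≤ 2ε·2^{kn}.) -/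
/-- Paper's Lemma 1: under single-edge robust decodability at the b-cut,
any plurality predictor `ψ` of `b_i` from `z'_i` over the good set `G` errs on at most
`2·|B_err|` good messages. -/
theorem lemma_one_psi_error_bound
    (k N : ℕ) (hk : 1 ≤ k) (hN : 1 ≤ N)
    (M : Type) [Fintype M] [DecidableEq M]
    (G : Finset M)
    (x y z' b : Fin k → M → Fin N)
    (f : Fin k → Fin N → Fin N → Fin N → Fin N)
    (bv : M → Fin k → Fin N)
    (D : (Fin k → Fin N) → M)
    (hb : ∀ i m, b i m = f i (x i m) (y i m) (z' i m))
    (hbv : ∀ m i, bv m i = b i m)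
    (hdec : ∀ m ∈ G, D (bv m) = m)
    (hdecx : ∀ m ∈ G, ∀ i v,
      D (Function.update (bv m) i (f i v (y i m) (z' i m))) = m)
    (hdecy : ∀ m ∈ G, ∀ i v,
      D (Function.update (bv m) i (f i (x i m) v (z' i m))) = m)
    (hdecz : ∀ m ∈ G, ∀ i v,
      D (Function.update (bv m) i (f i (x i m) (y i m) v)) = m)
    (i : Fin k) (ψ : Fin N → Fin N)
    (hψ : ∀ ζ β,
      (G.filter (fun m => z' i m = ζ ∧ b i m = β)).card ≤
      (G.filter (fun m => z' i m = ζ ∧ b i m = ψ ζ)).card) :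
    (G.filter (fun m => ψ (z' i m) ≠ b i m)).card ≤
      2 * (Finset.univ.filter (fun w : Fin k → Fin N => ∀ m ∈ G, w ≠ bv m)).card := by
  classical
  set B := Finset.univ.filter (fun w : Fin k → Fin N => ∀ m ∈ G, w ≠ bv m) with hB
  have hmem : ∀ m ∈ G, ∀ c, c ≠ b i m → D (Function.update (bv m) i c) = m →
      m ∈ B.image D := by
    intro m hm c hc hD
    refine Finset.mem_image.2 ⟨_, ?_, hD⟩
    rw [hB, Finset.mem_filter]
    refine ⟨Finset.mem_univ _, ?_⟩
    intro m' hm' he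
    have h1 : m = m' := by rw [← hD, he, hdec m' hm']
    subst h1
    have h2 := congrFun he i
    rw [Function.update_self, hbv] at h2
    exact hc h2
  have hpair : ∀ m₁ ∈ G, ∀ m₂ ∈ G, z' i m₁ = z' i m₂ → b i m₁ ≠ b i m₂ →
      m₁ ∉ B.image D → m₂ ∈ B.image D := by
    intro m₁ h₁ m₂ h₂ hz hne hn
    by_cases hc : f i (x i m₁) (y i m₂) (z' i m₁) = b i m₁
    · refine hmem m₂ h₂ (f i (x i m₁) (y i m₂) (z' i m₂)) ?_ (hdecx m₂ h₂ i _)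
      rw [← hz, hc]
      exact hne
    · exact absurd (hmem m₁ h₁ _ hc (hdecy m₁ h₁ i _)) hn
  have hfib : ∀ ζ : Fin N,
      ((G.filter (fun m => ψ (z' i m) ≠ b i m)).filter (fun m => z' i m = ζ)).card ≤
      ((B.image D).filter (fun m => z' i m = ζ)).card := by
    intro ζ
    by_cases hall : ∀ m ∈ G, z' i m = ζ → m ∈ B.image D
    · apply Finset.card_le_card
      intro m hm
      simp only [Finset.mem_filter] at hm
      exact Finset.mem_filter.2 ⟨hall m hm.1.1 hm.2, hm.2⟩
    · push Not at hall
      obtain ⟨m₀, h₀, hz₀, hn₀⟩ := hall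
      have hψ' := hψ ζ (b i m₀)
      have e : ∀ β, (G.filter (fun m => z' i m = ζ ∧ b i m = β)).card +
          (G.filter (fun m => z' i m = ζ ∧ b i m ≠ β)).card =
          (G.filter (fun m => z' i m = ζ)).card := by
        intro β
        rw [← Finset.card_filter_add_card_filter_not (s := G.filter (fun m => z' i m = ζ))
          (fun m => b i m = β), Finset.filter_filter, Finset.filter_filter]
      have e1 := e (b i m₀)
      have e2 := e (ψ ζ)
      have h3 : (G.filter (fun m => z' i m = ζ ∧ b i m ≠ b i m₀)).card ≤
          ((B.image D).filter (fun m => z' i m = ζ)).card := by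
        apply Finset.card_le_card
        intro m hm
        rw [Finset.mem_filter] at hm
        exact Finset.mem_filter.2
          ⟨hpair m₀ h₀ m hm.1 (hz₀.trans hm.2.1.symm) (Ne.symm hm.2.2) hn₀, hm.2.1⟩
      have h4 : ((G.filter (fun m => ψ (z' i m) ≠ b i m)).filter (fun m => z' i m = ζ)).card ≤
          (G.filter (fun m => z' i m = ζ ∧ b i m ≠ ψ ζ)).card := by
        apply Finset.card_le_card
        intro m hm
        simp only [Finset.mem_filter] at hm
        refine Finset.mem_filter.2 ⟨hm.1.1, hm.2, ?_⟩
        rw [← hm.2]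
        exact Ne.symm hm.1.2
      omega
  have hsum : (G.filter (fun m => ψ (z' i m) ≠ b i m)).card ≤ (B.image D).card := by
    rw [Finset.card_eq_sum_card_fiberwise (f := z' i) (t := Finset.univ)
        (s := G.filter (fun m => ψ (z' i m) ≠ b i m)) (fun _ _ => by simp),
      Finset.card_eq_sum_card_fiberwise (f := z' i) (t := Finset.univ)
        (s := B.image D) (fun _ _ => by simp)]
    exact Finset.sum_le_sum (fun ζ _ => hfib ζ)
  have := Finset.card_image_le (s := B) (f := D)
  omega
end

section
/- Under the abstract model of the reduction network with single-edge robust decodability at the b-cut and the a-side structure (x_i = ξ_i ∘ a_i and y_i = η_i ∘ a_i): for every i ∈ Fin k and every â ∈ Fin N, letting F = {m ∈ G : a_i m = â} and L = |{b_i m : m ∈ F}|, there exists a subset W ⊆ B_err with |W| ≥ (L − 1)·|F| such that every w ∈ W satisfies D w ∈ F. (Paper's Lemma 3: if the image of the a_i-fiber under b_i has L values, there are (L−1)·|F| distinct elements of B_err each decoded to some message in the fiber.) -/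
/-- Paper's Lemma 3: under single-edge robust decodability at the b-cut
and the a-side structure, for a coordinate `i` and a value `ahat`, if the `a_i`-fiber
`F = {m ∈ G : a_i m = ahat}` maps under `b_i` to `L` distinct values, then there are at
least `(L-1)·|F|` distinct elements of `B_err` each decoded to some message in `F`. -/
theorem lemma_three_fiber_image_bound
    (k N : ℕ) (hk : 1 ≤ k) (hN : 1 ≤ N)
    (M : Type) [Fintype M] [DecidableEq M]
    (G : Finset M)
    (x y z' b : Fin k → M → Fin N)
    (f : Fin k → Fin N → Fin N → Fin N → Fin N)
    (bv : M → Fin k → Fin N)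
    (D : (Fin k → Fin N) → M)
    (hb : ∀ i m, b i m = f i (x i m) (y i m) (z' i m))
    (hbv : ∀ m i, bv m i = b i m)
    (hdec : ∀ m ∈ G, D (bv m) = m)
    (hdecx : ∀ m ∈ G, ∀ i v,
      D (Function.update (bv m) i (f i v (y i m) (z' i m))) = m)
    (hdecy : ∀ m ∈ G, ∀ i v,
      D (Function.update (bv m) i (f i (x i m) v (z' i m))) = m)
    (hdecz : ∀ m ∈ G, ∀ i v,
      D (Function.update (bv m) i (f i (x i m) (y i m) v)) = m)
    (a : Fin k → M → Fin N) (ξ η : Fin k → Fin N → Fin N)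
    (hx : ∀ i m, x i m = ξ i (a i m))
    (hy : ∀ i m, y i m = η i (a i m))
    (i : Fin k) (ahat : Fin N) :
    ∃ W ⊆ Finset.univ.filter (fun w : Fin k → Fin N => ∀ m ∈ G, w ≠ bv m),
      (((G.filter (fun m => a i m = ahat)).image (b i)).card - 1)
          * (G.filter (fun m => a i m = ahat)).card ≤ W.card ∧
      ∀ w ∈ W, D w ∈ G.filter (fun m => a i m = ahat) := by
  set F := G.filter (fun m => a i m = ahat) with hF
  have key : ∀ m ∈ F, ∀ c ∈ F.image (b i), D (Function.update (bv m) i c) = m := by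
    intro m hm c hc
    obtain ⟨m', hm', rfl⟩ := Finset.mem_image.1 hc
    rw [hF, Finset.mem_filter] at hm hm'
    have h := hdecz m hm.1 i (z' i m')
    rw [hb, hx i m', hy i m', hm'.2]
    rw [hx i m, hy i m, hm.2] at h
    exact h
  let S : Finset (Σ _ : M, Fin N) := F.sigma (fun m => (F.image (b i)).erase (b i m))
  have hS : ∀ p ∈ S, p.1 ∈ F ∧ p.2 ≠ b i p.1 ∧ p.2 ∈ F.image (b i) := by
    intro p hp
    have h := Finset.mem_sigma.1 hp
    exact ⟨h.1, Finset.mem_erase.1 h.2⟩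
  refine ⟨S.image (fun p => Function.update (bv p.1) i p.2), ?_, ?_, ?_⟩
  · intro w hw
    obtain ⟨p, hp, rfl⟩ := Finset.mem_image.1 hw
    obtain ⟨h1, h2, h3⟩ := hS p hp
    refine Finset.mem_filter.2 ⟨Finset.mem_univ _, ?_⟩
    intro m hm he
    have hk1 := key _ h1 _ h3
    have he' : Function.update (bv p.1) i p.2 = bv m := he
    rw [he', hdec m hm] at hk1
    have h4 := congrFun he' i
    rw [Function.update_self, hbv, hk1] at h4
    exact h2 h4
  · rw [Finset.card_image_of_injOn (s := S)]
    · rw [Finset.card_sigma, Finset.sum_congr rfl (fun m hm =>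
        Finset.card_erase_of_mem (Finset.mem_image_of_mem (b i) hm))]
      rw [Finset.sum_const, smul_eq_mul, mul_comm]
    · rintro ⟨m, c⟩ hp ⟨m', c'⟩ hq he
      obtain ⟨h1, h2, h3⟩ := hS _ hp
      obtain ⟨h1', h2', h3'⟩ := hS _ hq
      have he' : Function.update (bv m) i c = Function.update (bv m') i c' := he
      have e1 : m = m' := by
        exact (key _ h1 _ h3).symm.trans ((congrArg D he').trans (key _ h1' _ h3'))
      have e2 : c = c' := by simpa using congrFun he' i
      rw [e1, e2]
  · intro w hw
    obtain ⟨p, hp, rfl⟩ := Finset.mem_image.1 hw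
    obtain ⟨h1, h2, h3⟩ := hS p hp
    have := key _ h1 _ h3
    exact this.symm ▸ h1
end

section
/- Let G be a finite set, let z : G → Z and c : G → C be functions to types with decidable equality, and let ψ : Z → C be any function such that for every ζ ∈ Z, ψ ζ maximizes β ↦ |{m ∈ G : z m = ζ ∧ c m = β}|. Then there exists a family P of pairwise disjoint two-element subsets of G, each pair {m₁, m₂} ∈ P satisfying z m₁ = z m₂ and c m₁ ≠ c m₂, such that 2·|P| ≥ |{m ∈ G : c m ≠ ψ (z m)}|. (The greedy pair-deletion argument in the proof of Lemma 1: the number of messages on which the plurality predictor errs is at most twice the number of disjoint within-fiber pairs with distinct c-values.) -/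
/-- The greedy pair-deletion argument in the proof of Lemma 1: for any
plurality predictor `ψ` of `c` from `z` over a finite set `G` (here the whole finite
type `α`), there is a family `P` of pairwise disjoint two-element subsets, each pair
lying in one `z`-fiber with distinct `c`-values, with `2·|P|` at least the number of
elements on which `ψ` errs. -/
theorem plurality_predictor_pair_deletion
    {α Z C : Type} [Fintype α] [DecidableEq α] [DecidableEq Z] [DecidableEq C]
    (z : α → Z) (c : α → C) (ψ : Z → C)
    (hψ : ∀ ζ β,
      (Finset.univ.filter (fun m : α => z m = ζ ∧ c m = β)).card ≤
      (Finset.univ.filter (fun m : α => z m = ζ ∧ c m = ψ ζ)).card) :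
    ∃ P : Finset (Finset α),
      (∀ p ∈ P, ∃ m₁ m₂ : α, m₁ ≠ m₂ ∧ p = {m₁, m₂} ∧ z m₁ = z m₂ ∧ c m₁ ≠ c m₂) ∧
      (∀ p ∈ P, ∀ q ∈ P, p ≠ q → Disjoint p q) ∧
      (Finset.univ.filter (fun m : α => c m ≠ ψ (z m))).card ≤ 2 * P.card := by
  classical
  let good : Finset (Finset α) → Prop := fun P =>
    (∀ p ∈ P, ∃ m₁ m₂ : α, m₁ ≠ m₂ ∧ p = {m₁, m₂} ∧ z m₁ = z m₂ ∧ c m₁ ≠ c m₂) ∧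
      (∀ p ∈ P, ∀ q ∈ P, p ≠ q → Disjoint p q)
  -- take a family of maximal cardinality
  obtain ⟨P, hP, hmax⟩ := Finset.exists_max_image (Finset.univ.filter good) Finset.card
    ⟨∅, by simp [good]⟩
  have hgood : good P := by simpa using hP
  refine ⟨P, hgood.1, hgood.2, ?_⟩
  -- uncovered elements of one fiber all have the same value of c
  have key : ∀ x y : α, x ∉ P.biUnion id → y ∉ P.biUnion id → z x = z y → c x = c y := by
    intro x y hx hy hz
    by_contra hc
    have hx' : ∀ p ∈ P, x ∉ p := by simpa using hx
    have hy' : ∀ p ∈ P, y ∉ p := by simpa using hy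
    have hnot : ({x, y} : Finset α) ∉ P := fun h => hx' _ h (by simp)
    have hdis : ∀ p ∈ P, Disjoint ({x, y} : Finset α) p := by
      intro p hp
      simp [Finset.disjoint_insert_left, hx' p hp, hy' p hp]
    have hg : good (insert {x, y} P) := by
      refine ⟨?_, ?_⟩
      · intro p hp
        rcases Finset.mem_insert.1 hp with rfl | hp
        · exact ⟨x, y, fun h => hc (by rw [h]), rfl, hz, hc⟩
        · exact hgood.1 p hp
      · intro p hp q hq hpq
        rcases Finset.mem_insert.1 hp with rfl | hp
        · rcases Finset.mem_insert.1 hq with rfl | hq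
          · exact absurd rfl hpq
          · exact hdis q hq
        · rcases Finset.mem_insert.1 hq with rfl | hq
          · exact (hdis p hp).symm
          · exact hgood.2 p hp q hq hpq
    have := hmax _ (Finset.mem_filter.2 ⟨Finset.mem_univ _, hg⟩)
    rw [Finset.card_insert_of_notMem hnot] at this
    omega
  have hcov : (P.biUnion id).card ≤ 2 * P.card := by
    rw [mul_comm]
    refine Finset.card_biUnion_le_card_mul _ _ _ ?_
    intro p hp
    obtain ⟨a, b, -, rfl, -⟩ := hgood.1 p hp
    exact Finset.card_le_two
  refine le_trans ?_ hcov
  rw [Finset.card_eq_sum_card_fiberwise (f := z) (t := Finset.univ.image z)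
      (fun x _ => by simp),
    Finset.card_eq_sum_card_fiberwise (f := z) (s := P.biUnion id) (t := Finset.univ.image z)
      (fun x _ => by simp)]
  refine Finset.sum_le_sum fun ζ _ => ?_
  let F : Finset α := Finset.univ.filter (fun m => z m = ζ)
  have h1 := Finset.card_filter_add_card_filter_not (s := F) (fun m => c m = ψ ζ)
  have h2 := Finset.card_filter_add_card_filter_not (s := F) (fun m => m ∈ P.biUnion id)
  have e1 : F.filter (fun m => c m = ψ ζ) =
      Finset.univ.filter (fun m => z m = ζ ∧ c m = ψ ζ) := by
    ext m; simp [F]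
  have e2 : F.filter (fun m => ¬ c m = ψ ζ) =
      (Finset.univ.filter (fun m => c m ≠ ψ (z m))).filter (fun m => z m = ζ) := by
    ext m
    simp only [F, Finset.mem_filter, Finset.mem_univ, true_and]
    constructor
    · rintro ⟨rfl, h⟩; exact ⟨h, rfl⟩
    · rintro ⟨h, rfl⟩; exact ⟨rfl, h⟩
  have e3 : F.filter (fun m => m ∈ P.biUnion id) =
      (P.biUnion id).filter (fun m => z m = ζ) := by
    ext m
    simp only [F, Finset.mem_filter, Finset.mem_univ, true_and]
    exact and_comm
  have h3 : (F.filter (fun m => ¬ m ∈ P.biUnion id)).card ≤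
      (Finset.univ.filter (fun m => z m = ζ ∧ c m = ψ ζ)).card := by
    rcases (F.filter (fun m => ¬ m ∈ P.biUnion id)).eq_empty_or_nonempty with h | ⟨x, hx⟩
    · rw [h]; simp
    · refine le_trans (Finset.card_le_card ?_) (hψ ζ (c x))
      intro y hy
      simp only [F, Finset.mem_filter, Finset.mem_univ, true_and] at hx hy ⊢
      exact ⟨hy.1, key y x hy.2 hx.2 (hy.1.trans hx.1.symm)⟩
  rw [e1, e2] at h1
  rw [e3] at h2
  omega
end

section
/- Let k ≥ 1 and N ≥ 1 be integers, G a finite type, a, b : G → (Fin k → Fin N) with b injective, and i ∈ Fin k. Let π : Fin N → Fin N be any function such that for each β ∈ Fin N, π β maximizes α ↦ |{m' ∈ G : (b m') i = β ∧ (a m') i = α}|. If m ∈ G satisfies 2·|{m' ∈ G : (a m') i = (a m) i}| > N^(k−1), and (b m') i = (b m) i for every m' ∈ G with (a m') i = (a m) i, then π ((b m) i) = (a m) i. (The claim establishing M^π_i ⊆ M^π_{i,1} ∪ M^π_{i,2} in the proof of Lemma 2: if the a_i-fiber of m is more than half-full and b_i is constant on it, the plurality predictor is correct at m; otherwise, by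 injectivity of b and the pigeonhole principle two good messages would share their entire b-vector.) -/
/-- The claim `M^π_i ⊆ M^π_{i,1} ∪ M^π_{i,2}` in the proof of Lemma 2:
if the `a_i`-fiber of `m` is more than half-full and `b_i` is constant on it, then any
plurality predictor `π` of `a_i` from `b_i` is correct at `m` (`b` injective). -/
theorem plurality_predictor_correct_on_large_constant_fiber
    (k N : ℕ) (hk : 1 ≤ k) (hN : 1 ≤ N)
    (G : Type) [Fintype G] [DecidableEq G]
    (a b : G → Fin k → Fin N) (hbinj : Function.Injective b)
    (i : Fin k) (π : Fin N → Fin N)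
    (hπ : ∀ β α,
      (Finset.univ.filter (fun m' : G => b m' i = β ∧ a m' i = α)).card ≤
      (Finset.univ.filter (fun m' : G => b m' i = β ∧ a m' i = π β)).card)
    (m : G)
    (h1 : N ^ (k - 1) < 2 * (Finset.univ.filter (fun m' : G => a m' i = a m i)).card)
    (h2 : ∀ m' : G, a m' i = a m i → b m' i = b m i) :
    π (b m i) = a m i := by
  classical
  by_contra hne
  have hF : (Finset.univ.filter (fun m' : G => a m' i = a m i)) =
      Finset.univ.filter (fun m' : G => b m' i = b m i ∧ a m' i = a m i) := by
    ext x
    simp only [Finset.mem_filter, Finset.mem_univ, true_and]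
    exact ⟨fun h => ⟨h2 x h, h⟩, fun h => h.2⟩
  have hP := hπ (b m i) (a m i)
  have hdisj : Disjoint
      (Finset.univ.filter (fun m' : G => b m' i = b m i ∧ a m' i = a m i))
      (Finset.univ.filter (fun m' : G => b m' i = b m i ∧ a m' i = π (b m i))) := by
    rw [Finset.disjoint_left]
    intro x hx hy
    simp only [Finset.mem_filter, Finset.mem_univ, true_and] at hx hy
    exact hne (hy.2.symm.trans hx.2)
  have hsub : (Finset.univ.filter (fun m' : G => b m' i = b m i ∧ a m' i = a m i)) ∪
      (Finset.univ.filter (fun m' : G => b m' i = b m i ∧ a m' i = π (b m i))) ⊆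
      Finset.univ.filter (fun m' : G => b m' i = b m i) := by
    intro x hx
    simp only [Finset.mem_union, Finset.mem_filter, Finset.mem_univ, true_and] at hx ⊢
    rcases hx with h | h <;> exact h.1
  have hle := Finset.card_le_card hsub
  rw [Finset.card_union_of_disjoint hdisj] at hle
  have hcap : (Finset.univ.filter (fun m' : G => b m' i = b m i)).card ≤ N ^ (k - 1) := by
    have h := Finset.card_le_card_of_injOn
      (s := Finset.univ.filter (fun m' : G => b m' i = b m i))
      (t := (Finset.univ : Finset ({j : Fin k // j ≠ i} → Fin N)))
      (fun x j => b x j.1) (fun _ _ => by simp) (by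
        intro x hx y hy hxy
        simp only [Finset.coe_filter, Finset.mem_univ, true_and, Set.mem_setOf_eq] at hx hy
        apply hbinj
        funext j
        by_cases hj : j = i
        · subst hj
          exact hx.trans hy.symm
        · exact congrFun hxy ⟨j, hj⟩)
    simpa [Fintype.card_subtype_compl] using h
  rw [hF] at h1
  omega
end

section
/- Under the abstract model of the reduction network with single-edge robust decodability at the b-cut and the a-side structure with the vector map a injective on G: for every i ∈ Fin k, the set of good messages lying in a more-than-half-full a_i-fiber on which b_i is non-constant is small: |{m ∈ G : 2·|{m' ∈ G : a_i m' = a_i m}| > N^(k−1) ∧ ∃ m' ∈ G, a_i m' = a_i m ∧ b_i m' ≠ b_i m}| ≤ 2·|B_err|. (The bound |M^π_{i,2}| ≤ 2ε·2^{kn} in the proof of Lemma 2, obtained via Lemma 3.) -/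
/-- Bound on `|M^π_{i,2}|` in the proof of Lemma 2: under single-edge
robust decodability at the b-cut and the a-side structure with the vector map `a`
injective on `G`, the set of good messages lying in a more-than-half-full `a_i`-fiber
on which `b_i` is non-constant has size at most `2·|B_err|`. -/
theorem pi_error_second_part_bound
    (k N : ℕ) (hk : 1 ≤ k) (hN : 1 ≤ N)
    (M : Type) [Fintype M] [DecidableEq M]
    (G : Finset M)
    (x y z' b : Fin k → M → Fin N)
    (f : Fin k → Fin N → Fin N → Fin N → Fin N)
    (bv : M → Fin k → Fin N)
    (D : (Fin k → Fin N) → M)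
    (hb : ∀ i m, b i m = f i (x i m) (y i m) (z' i m))
    (hbv : ∀ m i, bv m i = b i m)
    (hdec : ∀ m ∈ G, D (bv m) = m)
    (hdecx : ∀ m ∈ G, ∀ i v,
      D (Function.update (bv m) i (f i v (y i m) (z' i m))) = m)
    (hdecy : ∀ m ∈ G, ∀ i v,
      D (Function.update (bv m) i (f i (x i m) v (z' i m))) = m)
    (hdecz : ∀ m ∈ G, ∀ i v,
      D (Function.update (bv m) i (f i (x i m) (y i m) v)) = m)
    (a : Fin k → M → Fin N) (ξ η : Fin k → Fin N → Fin N)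
    (hx : ∀ i m, x i m = ξ i (a i m))
    (hy : ∀ i m, y i m = η i (a i m))
    (av : M → Fin k → Fin N)
    (hav : ∀ m i, av m i = a i m)
    (hainj : ∀ m₁ ∈ G, ∀ m₂ ∈ G, av m₁ = av m₂ → m₁ = m₂)
    (i : Fin k) :
    (G.filter (fun m =>
        N ^ (k - 1) < 2 * (G.filter (fun m' => a i m' = a i m)).card ∧
        ∃ m' ∈ G, a i m' = a i m ∧ b i m' ≠ b i m)).card ≤
      2 * (Finset.univ.filter (fun w : Fin k → Fin N => ∀ m ∈ G, w ≠ bv m)).card := by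
  classical
  have key : ∀ m ∈ G, ∀ m' ∈ G, a i m' = a i m →
      D (Function.update (bv m) i (b i m')) = m := by
    intro m hm m' _ h
    have e : b i m' = f i (x i m) (y i m) (z' i m') := by
      rw [hb, hx, hy, hx i m, hy i m, h]
    rw [e]
    exact hdecz m hm i _
  refine le_trans ?_ (Nat.le_mul_of_pos_left _ (by norm_num : 0 < 2))
  refine Finset.card_le_card_of_surjOn D ?_
  intro m hm
  have hm2 := Finset.mem_filter.1 (Finset.mem_coe.1 hm)
  obtain ⟨hmG, _, m', hm', h, hne⟩ := hm2
  refine ⟨Function.update (bv m) i (b i m'), ?_, key m hmG m' hm' h⟩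
  refine Finset.mem_coe.2 (Finset.mem_filter.2 ⟨Finset.mem_univ _, ?_⟩)
  intro m₁ hm₁ heq
  have h1 : m = m₁ := by
    rw [← key m hmG m' hm' h, heq, hdec m₁ hm₁]
  subst h1
  have h2 := congrFun heq i
  rw [Function.update_self, hbv] at h2
  exact hne h2
end
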